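/- arXiv:2007.07170 — 2 statements merged into one kernel-verified Lean document; each statement's English description precedes it below -/
import Mathlib

section
/- Let N ≥ 1 and let c, ĉ : Fin N → ℝ be the true and predicted costs of N action sequences, with the indexing sorted so that c 0 ≤ c i for every i (index 0 is the truly best action sequence), and let ε ≥ 0. Suppose (i) the prediction error on the best action sequence satisfies |c 0 − ĉ 0| < ε, and (ii) for every index i with c i > c 0 + ε the prediction error satisfies |c i − ĉ i| < (c i − c 0) − ε. Then the greedy policy that selects a minimizer of the predicted cost is ε-optimal: for every index i' such that ĉ i' ≤ ĉ j for all j, we have c i' ≤ c 0 + ε. -/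
/-- Theorem 3.1 of "Goal-Aware Prediction: Learning to Model What Matters":
if the cost prediction error on the best action sequence is below `ε`, and the
error on each significantly suboptimal action sequence `i` is below
`(c i - c 0) - ε`, then any index minimizing the predicted cost is `ε`-optimal. -/
theorem gap_epsilon_optimal
    (N : ℕ) (hN : 1 ≤ N) (c chat : Fin N → ℝ) (ε : ℝ) (hε : 0 ≤ ε)
    (hsort : ∀ i, c ⟨0, hN⟩ ≤ c i)
    (hbest : |c ⟨0, hN⟩ - chat ⟨0, hN⟩| < ε)
    (hsub : ∀ i, c i > c ⟨0, hN⟩ + ε → |c i - chat i| < (c i - c ⟨0, hN⟩) - ε)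
    (i' : Fin N) (hmin : ∀ j, chat i' ≤ chat j) :
    c i' ≤ c ⟨0, hN⟩ + ε := by
  by_contra! h
  have h₀ := (abs_lt.mp hbest).1
  have h₁ := (abs_lt.mp (hsub i' h)).2
  linarith [hmin ⟨0, hN⟩]
end

section
/- Let c, ĉ : Fin N → ℝ with c 0 ≤ c i for every i, and let ε ≥ 0. If an index i' minimizing the predicted cost ĉ is significantly suboptimal, i.e. c i' > c 0 + ε, then at least one of the two error bounds must fail: either |c 0 − ĉ 0| ≥ ε, or there exists an index i with c i > c 0 + ε such that |c i − ĉ i| ≥ (c i − c 0) − ε. -/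
/-- Contrapositive of Theorem 3.1: if a minimizer of the predicted cost is
significantly suboptimal, then one of the two error bounds must fail. -/
theorem gap_failure_implies_error_bound_violated
    (N : ℕ) (hN : 1 ≤ N) (c chat : Fin N → ℝ) (ε : ℝ) (hε : 0 ≤ ε)
    (hsort : ∀ i, c ⟨0, hN⟩ ≤ c i)
    (i' : Fin N) (hmin : ∀ j, chat i' ≤ chat j)
    (hfail : c i' > c ⟨0, hN⟩ + ε) :
    |c ⟨0, hN⟩ - chat ⟨0, hN⟩| ≥ ε ∨
      ∃ i, c i > c ⟨0, hN⟩ + ε ∧ |c i - chat i| ≥ (c i - c ⟨0, hN⟩) - ε := by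
  refine or_iff_not_imp_left.mpr fun h => ⟨i', hfail, ?_⟩
  have h0 := neg_lt_of_abs_lt (not_le.mp h)
  have h1 := le_abs_self (c i' - chat i')
  linarith [hmin ⟨0, hN⟩]
end
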